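/- Let B be a finite-dimensional k-algebra and σ a k-algebra automorphism of B. Then there is an isomorphism of categories T(B)-gr ≅ T(B^σ)-gr between the categories of finite-dimensional graded left modules over the trivial extension T(B) and the twisted trivial extension T(B^σ). Explicitly, a graded T(B)-module M becomes a graded T(B^σ)-module via (b,f) ⋆ m = σ^{|m|}(b)m + (f ∘ σ^{−|m|})m for homogeneous m of degree |m|, and this assignment (identity on morphisms) is an isomorphism of categories. -/

import Mathlib

/-!
STATEMENT 2: For a finite-dimensional `k`-algebra `B` and a `k`-algebra automorphism
`σ` of `B`, there is an isomorphism of categories `T(B)-gr ≅ T(B^σ)-gr` between the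
categories of finite-dimensional graded left modules over the trivial extension
`T(B) = B ⋉ D(B)` and the twisted trivial extension `T(B^σ) = B ⋉ D(B^σ)`; it is the
identity on underlying spaces.
-/

open CategoryTheory MulOpposite
set_option synthInstance.maxHeartbeats 1000000
set_option maxHeartbeats 1000000
set_option linter.unusedVariables false

/-- The category of finite-dimensional `ℤ`-graded left modules (with degree-preserving
morphisms) over an algebra `A` graded by `𝒜 : ℕ → Submodule k A`. -/
structure GrMod (k : Type) [Field k] (A : Type) [Ring A] [Algebra k A]
    (𝒜 : ℕ → Submodule k A) : Type 1 where
  carrier : Type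
  [acg : AddCommGroup carrier]
  [modA : Module A carrier]
  [modk : Module k carrier]
  [tower : IsScalarTower k A carrier]
  [fd : FiniteDimensional k carrier]
  grading : ℤ → Submodule k carrier
  internal : DirectSum.IsInternal grading
  smul_mem : ∀ (i : ℕ) (j : ℤ) (a : A) (m : carrier),
    a ∈ 𝒜 i → m ∈ grading j → a • m ∈ grading (i + j)

attribute [instance] GrMod.acg GrMod.modA GrMod.modk GrMod.tower GrMod.fd

instance GrMod.instCategory {k : Type} [Field k] {A : Type} [Ring A] [Algebra k A]
    {𝒜 : ℕ → Submodule k A} : CategoryTheory.Category (GrMod k A 𝒜) where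
  Hom M N := {f : M.carrier →ₗ[A] N.carrier // ∀ (j : ℤ), ∀ m ∈ M.grading j, f m ∈ N.grading j}
  id M := ⟨LinearMap.id, fun _ _ hm => hm⟩
  comp f g := ⟨g.1.comp f.1, fun j m hm => g.2 j _ (f.2 j m hm)⟩

section Dual
variable (k : Type) [Field k] (B : Type) [Ring B] [Algebra k B]

/-- The left `B`-action on `D(B) = Hom_k(B,k)`: `(b • f) y = f (y * b)`. -/
noncomputable instance dualLeftModule : Module B (Module.Dual k B) where
  smul b f := f.comp (LinearMap.mulRight k b)
  one_smul f := by ext y; show f (y * 1) = f y; rw [mul_one]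
  mul_smul b b' f := by ext y; show f (y * (b * b')) = f (y * b * b'); rw [mul_assoc]
  smul_zero b := rfl
  smul_add b f g := rfl
  add_smul b b' f := by ext y; show f (y * (b + b')) = f (y * b) + f (y * b'); rw [mul_add, map_add]
  zero_smul f := by ext y; show f (y * 0) = 0; rw [mul_zero, map_zero]

/-- The right `B`-action on `D(B)`: `(f • b) y = f (b * y)`. -/
noncomputable instance dualRightModule : Module Bᵐᵒᵖ (Module.Dual k B) where
  smul b f := f.comp (LinearMap.mulLeft k (unop b))
  one_smul f := by ext y; show f (1 * y) = f y; rw [one_mul]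
  mul_smul b b' f := by
    ext y; show f ((unop b' * unop b) * y) = f (unop b' * (unop b * y)); rw [mul_assoc]
  smul_zero b := rfl
  smul_add b f g := rfl
  add_smul b b' f := by
    ext y; show f ((unop b + unop b') * y) = f (unop b * y) + f (unop b' * y)
    rw [add_mul, map_add]
  zero_smul f := by ext y; show f (0 * y) = 0; rw [zero_mul, map_zero]

instance : SMulCommClass B Bᵐᵒᵖ (Module.Dual k B) where
  smul_comm b b' f := by
    ext y; show f (unop b' * (y * b)) = f ((unop b' * y) * b); rw [mul_assoc]

instance : IsScalarTower k B (Module.Dual k B) where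
  smul_assoc r b f := by
    ext y; show f (y * (r • b)) = r • f (y * b)
    rw [mul_smul_comm, map_smul]

instance : IsScalarTower k Bᵐᵒᵖ (Module.Dual k B) where
  smul_assoc r b f := by
    ext y
    show f ((unop (r • b)) * y) = r • f (unop b * y)
    rw [unop_smul, smul_mul_assoc, map_smul]

end Dual
section DualT
variable (k : Type) [Field k] (B : Type) [Ring B] [Algebra k B]

/-- `D(B^σ)`: the dual of the twisted bimodule `B^σ`; as a set it is `Hom_k(B,k)`, with
left `B`-action `(b • f) y = f (y * σ b)` and right `B`-action `(f • b) y = f (b * y)`. -/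
def DualT (σ : B ≃ₐ[k] B) : Type := Module.Dual k B

variable (σ : B ≃ₐ[k] B)

/-- The twisted left action on the dual. -/
def dualTLeftModule : Module B (Module.Dual k B) where
  smul b f := f.comp (LinearMap.mulRight k (σ b))
  one_smul f := by ext y; show f (y * σ 1) = f y; rw [map_one, mul_one]
  mul_smul b b' f := by
    ext y; show f (y * σ (b * b')) = f (y * σ b * σ b'); rw [map_mul σ b b', mul_assoc]
  smul_zero b := rfl
  smul_add b f g := rfl
  add_smul b b' f := by
    ext y; show f (y * σ (b + b')) = f (y * σ b) + f (y * σ b'); rw [map_add, mul_add, map_add]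
  zero_smul f := by ext y; show f (y * σ 0) = 0; rw [map_zero, mul_zero, map_zero]

/-- The (untwisted) right action on the dual. -/
def dualTRightModule : Module Bᵐᵒᵖ (Module.Dual k B) where
  smul b f := f.comp (LinearMap.mulLeft k (unop b))
  one_smul f := by ext y; show f (1 * y) = f y; rw [one_mul]
  mul_smul b b' f := by
    ext y; show f ((unop b' * unop b) * y) = f (unop b' * (unop b * y)); rw [mul_assoc]
  smul_zero b := rfl
  smul_add b f g := rfl
  add_smul b b' f := by
    ext y; show f ((unop b + unop b') * y) = f (unop b * y) + f (unop b' * y)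
    rw [add_mul, map_add]
  zero_smul f := by ext y; show f (0 * y) = 0; rw [zero_mul, map_zero]

/-- Reinterpret an element of `DualT` as a linear functional. -/
def DualT.lin (f : DualT k B σ) : Module.Dual k B := f

instance : AddCommGroup (DualT k B σ) := inferInstanceAs (AddCommGroup (Module.Dual k B))
instance : Module k (DualT k B σ) := inferInstanceAs (Module k (Module.Dual k B))
instance : Module B (DualT k B σ) := dualTLeftModule k B σ
instance : Module Bᵐᵒᵖ (DualT k B σ) := dualTRightModule k B

instance : SMulCommClass B Bᵐᵒᵖ (DualT k B σ) where
  smul_comm b b' f :=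
    LinearMap.ext (fun y => congrArg (DualT.lin k B σ f) (mul_assoc (unop b') y (σ b)).symm)

instance : IsScalarTower k B (DualT k B σ) where
  smul_assoc r b f := LinearMap.ext (fun y => by
    change DualT.lin k B σ f (y * σ (r • b)) = r • DualT.lin k B σ f (y * σ b)
    rw [map_smul σ, mul_smul_comm, map_smul])

instance : IsScalarTower k Bᵐᵒᵖ (DualT k B σ) where
  smul_assoc r b f := LinearMap.ext (fun y => by
    change DualT.lin k B σ f ((unop (r • b)) * y) = r • DualT.lin k B σ f (unop b * y)
    rw [unop_smul, smul_mul_assoc, map_smul])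

noncomputable example : Ring (TrivSqZeroExt B (DualT k B σ)) := inferInstance
noncomputable example : Algebra k (TrivSqZeroExt B (DualT k B σ)) := inferInstance

end DualT
section Grading
variable (k : Type) [Field k] (B X : Type) [Ring B] [Algebra k B]
  [AddCommGroup X] [Module B X] [Module Bᵐᵒᵖ X] [SMulCommClass B Bᵐᵒᵖ X]
  [Module k X] [IsScalarTower k B X] [IsScalarTower k Bᵐᵒᵖ X]

/-- The degree-`0` component of `B ⋉ X`, namely `B`. -/
def tszDegZero : Submodule k (TrivSqZeroExt B X) where
  carrier := {p | TrivSqZeroExt.snd p = 0}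
  zero_mem' := rfl
  add_mem' := by
    intro p q hp hq
    show TrivSqZeroExt.snd (p + q) = 0
    rw [TrivSqZeroExt.snd_add, hp, hq, add_zero]
  smul_mem' := by
    intro r p hp
    show TrivSqZeroExt.snd (r • p) = 0
    rw [TrivSqZeroExt.snd_smul, hp, smul_zero]

/-- The degree-`1` component of `B ⋉ X`, namely `X`. -/
def tszDegOne : Submodule k (TrivSqZeroExt B X) where
  carrier := {p | TrivSqZeroExt.fst p = 0}
  zero_mem' := rfl
  add_mem' := by
    intro p q hp hq
    show TrivSqZeroExt.fst (p + q) = 0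
    rw [TrivSqZeroExt.fst_add, hp, hq, add_zero]
  smul_mem' := by
    intro r p hp
    show TrivSqZeroExt.fst (r • p) = 0
    rw [TrivSqZeroExt.fst_smul, hp, smul_zero]

/-- The grading of the trivial extension `B ⋉ X`: `B` in degree `0`, `X` in degree `1`,
and `0` elsewhere. -/
def tszGrading : ℕ → Submodule k (TrivSqZeroExt B X)
  | 0 => tszDegZero k B X
  | 1 => tszDegOne k B X
  | _ + 2 => ⊥

end Grading
/-- `T(B)`-gr : graded modules over the trivial extension `T(B) = B ⋉ D(B)`. -/
noncomputable abbrev TBGr (k : Type) [Field k] (B : Type) [Ring B] [Algebra k B] : Type 1 :=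
  GrMod k (TrivSqZeroExt B (Module.Dual k B))
    (tszGrading k B (Module.Dual k B))

/-- `T(B^σ)`-gr : graded modules over the twisted trivial extension `T(B^σ) = B ⋉ D(B^σ)`. -/
noncomputable abbrev TBσGr (k : Type) [Field k] (B : Type) [Ring B] [Algebra k B]
    (σ : B ≃ₐ[k] B) : Type 1 :=
  GrMod k (TrivSqZeroExt B (DualT k B σ)) (tszGrading k B (DualT k B σ))

/-- A twisting system between two graded algebras: linear equivalences `C ≃ A`, one for each
degree `n : ℤ`, which preserve degrees and satisfy `φₙ (a * b) = φₙ₊ᵢ a * φₙ b` for `b` of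
degree `i`. -/
structure TwistingSystem (k : Type) [Field k] {A C : Type} [Ring A] [Algebra k A] [Ring C]
    [Algebra k C] (𝒜 : ℕ → Submodule k A) (𝒞 : ℕ → Submodule k C) where
  toEquiv : ℤ → C ≃ₗ[k] A
  iSup_eq_top : ⨆ i, 𝒜 i = ⊤
  iSup_eq_top' : ⨆ i, 𝒞 i = ⊤
  map_one : ∀ n, toEquiv n 1 = 1
  map_mem_iff : ∀ n i a, toEquiv n a ∈ 𝒜 i ↔ a ∈ 𝒞 i
  map_mul : ∀ (n : ℤ) (i : ℕ) (a b : C), b ∈ 𝒞 i →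
    toEquiv n (a * b) = toEquiv (i + n) a * toEquiv n b

namespace GrMod

variable {k : Type} [Field k] {A : Type} [Ring A] [Algebra k A] {𝒜 : ℕ → Submodule k A}

theorem induction_homogeneous (M : GrMod k A 𝒜) {p : M.carrier → Prop} (m : M.carrier)
    (homogeneous : ∀ n, ∀ x ∈ M.grading n, p x) (add : ∀ x y, p x → p y → p (x + y)) : p m :=
  Submodule.iSup_induction M.grading (motive := p)
    (M.internal.submodule_iSup_eq_top ▸ Submodule.mem_top : m ∈ ⨆ n, M.grading n)
    homogeneous (homogeneous 0 0 (zero_mem _)) add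

theorem mk_eq_self (M : GrMod k A 𝒜) (modA : Module A M.carrier) (h : modA = M.modA)
    (tower : IsScalarTower k A M.carrier)
    (smul_mem : ∀ (i : ℕ) (j : ℤ) (a : A) (m : M.carrier),
      a ∈ 𝒜 i → m ∈ M.grading j → a • m ∈ M.grading (i + j)) :
    { carrier := M.carrier, modA := modA, tower := tower, grading := M.grading,
      internal := M.internal, smul_mem := smul_mem : GrMod k A 𝒜 } = M := by
  subst h; rfl

theorem eqToHom_apply {M N : GrMod k A 𝒜} (h : M = N) (x : M.carrier) :
    (eqToHom h).1 x = cast (congrArg GrMod.carrier h) x := by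
  subst h; rfl

/-- The linear map acting on the degree `n` part of `M` as `φ n`. -/
noncomputable def piecewise (M : GrMod k A 𝒜) (φ : ℤ → M.carrier →ₗ[k] M.carrier) :
    M.carrier →ₗ[k] M.carrier :=
  (DirectSum.toModule k ℤ M.carrier fun n => (φ n).comp (M.grading n).subtype).comp
    (LinearEquiv.ofBijective (DirectSum.coeLinearMap M.grading) M.internal).symm.toLinearMap

theorem piecewise_apply (M : GrMod k A 𝒜) (φ : ℤ → M.carrier →ₗ[k] M.carrier) {n : ℤ}
    {m : M.carrier} (hm : m ∈ M.grading n) : M.piecewise φ m = φ n m := by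
  have h : (LinearEquiv.ofBijective (DirectSum.coeLinearMap M.grading) M.internal).symm m
      = DirectSum.lof k ℤ (fun n => M.grading n) n ⟨m, hm⟩ := by
    rw [LinearEquiv.symm_apply_eq]
    exact (DirectSum.coeLinearMap_lof M.grading n ⟨m, hm⟩).symm
  rw [piecewise, LinearMap.comp_apply, LinearEquiv.coe_coe, h, DirectSum.toModule_lof]
  rfl

end GrMod

namespace TwistingSystem

variable {k : Type} [Field k] {A C : Type} [Ring A] [Algebra k A] [Ring C] [Algebra k C]
  {𝒜 : ℕ → Submodule k A} {𝒞 : ℕ → Submodule k C}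

/-- The inverse twisting system. -/
def symm (φ : TwistingSystem k 𝒜 𝒞) : TwistingSystem k 𝒞 𝒜 where
  toEquiv n := (φ.toEquiv n).symm
  iSup_eq_top := φ.iSup_eq_top'
  iSup_eq_top' := φ.iSup_eq_top
  map_one n := by rw [LinearEquiv.symm_apply_eq, φ.map_one]
  map_mem_iff n i a := by
    rw [← φ.map_mem_iff n, LinearEquiv.apply_symm_apply]
  map_mul n i a b hb := by
    rw [LinearEquiv.symm_apply_eq, φ.map_mul n i _ _ (by
      rwa [← φ.map_mem_iff n, LinearEquiv.apply_symm_apply])]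
    simp

/-- The twisted action of `a : C` on a graded `A`-module. -/
noncomputable def act (φ : TwistingSystem k 𝒜 𝒞) (M : GrMod k A 𝒜) (a : C) :
    M.carrier →ₗ[k] M.carrier :=
  M.piecewise fun n => Algebra.lsmul k k M.carrier (φ.toEquiv n a)

theorem act_apply (φ : TwistingSystem k 𝒜 𝒞) (M : GrMod k A 𝒜) (a : C) {n : ℤ}
    {m : M.carrier} (hm : m ∈ M.grading n) : φ.act M a m = φ.toEquiv n a • m :=
  M.piecewise_apply _ hm

theorem act_one (φ : TwistingSystem k 𝒜 𝒞) (M : GrMod k A 𝒜) (m : M.carrier) :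
    φ.act M 1 m = m := by
  induction m using M.induction_homogeneous with
  | homogeneous n x hx => rw [φ.act_apply M _ hx, φ.map_one, one_smul]
  | add x y hx hy => rw [map_add, hx, hy]

theorem act_add (φ : TwistingSystem k 𝒜 𝒞) (M : GrMod k A 𝒜) (a b : C) (m : M.carrier) :
    φ.act M (a + b) m = φ.act M a m + φ.act M b m := by
  induction m using M.induction_homogeneous with
  | homogeneous n x hx => simp only [φ.act_apply M _ hx, map_add, add_smul]
  | add x y hx hy => simp only [map_add, hx, hy]; abel

theorem act_smul (φ : TwistingSystem k 𝒜 𝒞) (M : GrMod k A 𝒜) (r : k) (a : C)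
    (m : M.carrier) : φ.act M (r • a) m = r • φ.act M a m := by
  induction m using M.induction_homogeneous with
  | homogeneous n x hx => simp only [φ.act_apply M _ hx, map_smul, smul_assoc]
  | add x y hx hy => simp only [map_add, hx, hy, smul_add]

theorem act_mem (φ : TwistingSystem k 𝒜 𝒞) (M : GrMod k A 𝒜) {i : ℕ} {n : ℤ} {a : C}
    {m : M.carrier} (ha : a ∈ 𝒞 i) (hm : m ∈ M.grading n) :
    φ.act M a m ∈ M.grading (i + n) := by
  rw [φ.act_apply M a hm]
  exact M.smul_mem i n _ _ ((φ.map_mem_iff n i a).2 ha) hm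

theorem act_mul (φ : TwistingSystem k 𝒜 𝒞) (M : GrMod k A 𝒜) (a b : C) (m : M.carrier) :
    φ.act M (a * b) m = φ.act M a (φ.act M b m) := by
  induction m using M.induction_homogeneous with
  | homogeneous n x hx =>
    have homogeneous : ∀ (i : ℕ), ∀ b ∈ 𝒞 i,
        φ.act M (a * b) x = φ.act M a (φ.act M b x) := by
      intro i b hb
      rw [φ.act_apply M a (φ.act_mem M hb hx), φ.act_apply M _ hx, φ.act_apply M _ hx,
        φ.map_mul n i a b hb, mul_smul]
    refine Submodule.iSup_induction 𝒞 (motive := fun b =>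
      φ.act M (a * b) x = φ.act M a (φ.act M b x))
      (φ.iSup_eq_top' ▸ Submodule.mem_top : b ∈ ⨆ i, 𝒞 i) homogeneous
      (homogeneous 0 0 (zero_mem _)) ?_
    intro b c hb hc
    rw [mul_add, φ.act_add, φ.act_add, hb, hc, map_add]
  | add x y hx hy => simp only [map_add, hx, hy]

/-- The twisted `C`-module structure on a graded `A`-module. -/
noncomputable abbrev module (φ : TwistingSystem k 𝒜 𝒞) (M : GrMod k A 𝒜) :
    Module C M.carrier where
  smul a m := φ.act M a m
  one_smul := φ.act_one M
  mul_smul := φ.act_mul M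
  smul_zero a := map_zero (φ.act M a)
  smul_add a := map_add (φ.act M a)
  add_smul := φ.act_add M
  zero_smul m := by
    change φ.act M 0 m = 0
    simpa using φ.act_smul M 0 0 m

/-- The twist of a graded `A`-module, a graded `C`-module on the same graded space. -/
noncomputable def obj (φ : TwistingSystem k 𝒜 𝒞) (M : GrMod k A 𝒜) : GrMod k C 𝒞 :=
  letI := φ.module M
  { carrier := M.carrier
    acg := M.acg
    modA := φ.module M
    modk := M.modk
    tower := ⟨φ.act_smul M⟩
    fd := M.fd
    grading := M.grading
    internal := M.internal
    smul_mem := fun _ _ _ _ ha hm => φ.act_mem M ha hm }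

/-- Twisting, as a functor which is the identity on underlying maps. -/
noncomputable def functor (φ : TwistingSystem k 𝒜 𝒞) : GrMod k A 𝒜 ⥤ GrMod k C 𝒞 where
  obj := φ.obj
  map {M N} f :=
    ⟨{ toFun := f.1
       map_add' := f.1.map_add
       map_smul' := fun a m => by
        change f.1 (φ.act M a m) = φ.act N a (f.1 m)
        induction m using M.induction_homogeneous with
        | homogeneous n x hx =>
          rw [φ.act_apply M a hx, φ.act_apply N a (f.2 n x hx), map_smul]
        | add x y hx hy => simp only [map_add, hx, hy] }, f.2⟩
  map_id _ := rfl
  map_comp _ _ := rfl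

theorem symm_act_obj (φ : TwistingSystem k 𝒜 𝒞) (M : GrMod k A 𝒜) (a : A) (m : M.carrier) :
    φ.symm.act (φ.obj M) a m = a • m := by
  induction m using M.induction_homogeneous with
  | homogeneous n x hx =>
    refine (φ.symm.act_apply (φ.obj M) a (n := n) hx).trans ?_
    change φ.act M ((φ.toEquiv n).symm a) x = _
    rw [φ.act_apply M _ hx, LinearEquiv.apply_symm_apply]
  | add x y hx hy =>
    rw [smul_add, ← hx, ← hy]
    exact map_add (φ.symm.act (φ.obj M) a) x y

theorem symm_obj_obj (φ : TwistingSystem k 𝒜 𝒞) (M : GrMod k A 𝒜) :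
    φ.symm.obj (φ.obj M) = M := by
  have h : φ.symm.module (φ.obj M) = M.modA :=
    Module.ext' _ _ (φ.symm_act_obj M)
  exact M.mk_eq_self _ h (φ.symm.obj (φ.obj M)).tower (φ.symm.obj (φ.obj M)).smul_mem

theorem functor_comp_symm (φ : TwistingSystem k 𝒜 𝒞) :
    φ.functor ⋙ φ.symm.functor = 𝟭 (GrMod k A 𝒜) := by
  refine CategoryTheory.Functor.ext φ.symm_obj_obj fun M N f => ?_
  refine Subtype.ext (LinearMap.ext fun x => ?_)
  refine Eq.trans ?_ (GrMod.eqToHom_apply (φ.symm_obj_obj N).symm _).symm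
  exact congrArg f.1 (GrMod.eqToHom_apply (φ.symm_obj_obj M) x).symm

end TwistingSystem

theorem iSup_tszGrading (k : Type) [Field k] (B X : Type) [Ring B] [Algebra k B]
    [AddCommGroup X] [Module B X] [Module Bᵐᵒᵖ X] [SMulCommClass B Bᵐᵒᵖ X]
    [Module k X] [IsScalarTower k B X] [IsScalarTower k Bᵐᵒᵖ X] :
    ⨆ i, tszGrading k B X i = ⊤ := by
  refine eq_top_iff.2 fun p _ => ?_
  rw [← TrivSqZeroExt.inl_fst_add_inr_snd_eq p]
  exact add_mem (Submodule.mem_iSup_of_mem 0 (TrivSqZeroExt.snd_inl X p.fst))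
    (Submodule.mem_iSup_of_mem 1 (TrivSqZeroExt.fst_inr B p.snd))

/-- The linear equivalence `(b, f) ↦ (σⁿ b, f ∘ σ⁻ⁿ)` from `T(B^σ)` to `T(B)`. -/
noncomputable def trivExtTwist (k : Type) [Field k] (B : Type) [Ring B] [Algebra k B]
    (σ : B ≃ₐ[k] B) (n : ℤ) :
    TrivSqZeroExt B (DualT k B σ) ≃ₗ[k] TrivSqZeroExt B (Module.Dual k B) :=
  LinearEquiv.prodCongr (σ ^ n).toLinearEquiv (σ ^ n).toLinearEquiv.dualMap.symm

section trivExtTwist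

variable {k : Type} [Field k] {B : Type} [Ring B] [Algebra k B] {σ : B ≃ₐ[k] B} {n : ℤ}

theorem trivExtTwist_fst (p : TrivSqZeroExt B (DualT k B σ)) :
    (trivExtTwist k B σ n p).fst = (σ ^ n) p.fst := rfl

theorem trivExtTwist_snd_apply (p : TrivSqZeroExt B (DualT k B σ)) (y : B) :
    (trivExtTwist k B σ n p).snd y = DualT.lin k B σ p.snd ((σ ^ n).symm y) := rfl

theorem trivExtTwist_snd_eq_zero {p : TrivSqZeroExt B (DualT k B σ)} (hp : p.snd = 0) :
    (trivExtTwist k B σ n p).snd = 0 :=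
  LinearMap.ext fun y => by rw [trivExtTwist_snd_apply, hp]; rfl

end trivExtTwist

/-- The twisting system `(b, f) ↦ (σⁿ b, f ∘ σ⁻ⁿ)` between `T(B)` and `T(B^σ)`. -/
noncomputable def trivExtTwistingSystem (k : Type) [Field k] (B : Type) [Ring B] [Algebra k B]
    (σ : B ≃ₐ[k] B) :
    TwistingSystem k (tszGrading k B (Module.Dual k B)) (tszGrading k B (DualT k B σ)) where
  toEquiv := trivExtTwist k B σ
  iSup_eq_top := iSup_tszGrading k B _
  iSup_eq_top' := iSup_tszGrading k B _
  map_one n := TrivSqZeroExt.ext (map_one (σ ^ n)) rfl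
  map_mem_iff n i a := by
    match i with
    | 0 => exact (σ ^ n).toLinearEquiv.dualMap.symm.map_eq_zero_iff
    | 1 => exact (σ ^ n).toLinearEquiv.map_eq_zero_iff
    | _ + 2 => exact (trivExtTwist k B σ n).map_eq_zero_iff
  map_mul n i a b hb := by
    match i, hb with
    | 0, hb =>
      have hb : b.snd = 0 := hb
      rw [Nat.cast_zero, zero_add]
      refine TrivSqZeroExt.ext (map_mul (σ ^ n) a.fst b.fst) (LinearMap.ext fun y => ?_)
      rw [trivExtTwist_snd_apply, TrivSqZeroExt.snd_mul, TrivSqZeroExt.snd_mul, hb, smul_zero,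
        zero_add, trivExtTwist_snd_eq_zero hb, smul_zero, zero_add]
      change DualT.lin k B σ a.snd (b.fst * (σ ^ n).symm y)
        = DualT.lin k B σ a.snd ((σ ^ n).symm ((σ ^ n) b.fst * y))
      rw [map_mul (σ ^ n).symm, AlgEquiv.symm_apply_apply]
    | 1, hb =>
      have hb : b.fst = 0 := hb
      have hb' : (trivExtTwist k B σ n b).fst = 0 := by
        rw [trivExtTwist_fst, hb, map_zero]
      refine TrivSqZeroExt.ext ?_ (LinearMap.ext fun y => ?_)
      · rw [trivExtTwist_fst, TrivSqZeroExt.fst_mul, TrivSqZeroExt.fst_mul, hb, hb', mul_zero,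
          mul_zero, map_zero]
      · rw [trivExtTwist_snd_apply, TrivSqZeroExt.snd_mul, TrivSqZeroExt.snd_mul, hb, hb',
          op_zero, zero_smul, zero_smul, add_zero, add_zero]
        change DualT.lin k B σ b.snd ((σ ^ n).symm y * σ a.fst)
          = DualT.lin k B σ b.snd ((σ ^ n).symm (y * (σ ^ (((1 : ℕ) : ℤ) + n)) a.fst))
        rw [map_mul (σ ^ n).symm, add_comm, zpow_add, Nat.cast_one, zpow_one, AlgEquiv.mul_apply,
          AlgEquiv.symm_apply_apply]
    | _ + 2, hb =>
      have hb : b = 0 := hb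
      rw [hb, mul_zero, map_zero, mul_zero]

theorem twisted_trivExt_graded_modules_isomorphic
    (k : Type) [Field k] (B : Type) [Ring B] [Algebra k B] [FiniteDimensional k B]
    (σ : B ≃ₐ[k] B) :
    ∃ (F : TBGr k B ⥤ TBσGr k B σ) (G : TBσGr k B σ ⥤ TBGr k B),
      F ⋙ G = Functor.id (TBGr k B) ∧ G ⋙ F = Functor.id (TBσGr k B σ) ∧
      (∀ M : TBGr k B, (F.obj M).carrier = M.carrier) ∧
      (∀ N : TBσGr k B σ, (G.obj N).carrier = N.carrier) :=
  let φ := trivExtTwistingSystem k B σ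
  ⟨φ.functor, φ.symm.functor, φ.functor_comp_symm, φ.symm.functor_comp_symm,
    fun _ => rfl, fun _ => rfl⟩
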